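/- arXiv:2505.16644 — 2 statements merged into one kernel-verified Lean document; each statement's English description precedes it below -/
import Mathlib

section
/- Let A be a d×d real matrix, b ∈ ℝ^d, and σ a d×d real matrix. Let M : ℝ → Matrix (Fin d) (Fin d) ℝ with M(t) symmetric for every t, c : ℝ → ℝ^d, and δ : ℝ → ℝ be functions such that for every t: M has derivative M(t)·M(t) − Aᵀ·M(t) − M(t)·A at t, c has derivative M(t)·c(t) − Aᵀ·c(t) − M(t)·b at t, and δ has derivative (1/2)‖c(t)‖² − ⟨b, c(t)⟩ − (1/2)·trace(σ·σᵀ·M(t)) at t. Define the value function V(t, x) = (1/2)⟨x, M(t)·x⟩ + ⟨c(t), x⟩ + δ(t). Then for every x ∈ ℝ^d and every t, the function t ↦ V(t, x) has derivative at t equal to (1/2)‖M(t)·x + c(t)‖² − ⟨A·x + b, M(t)·x + c(t)⟩ − (1/2)·trace(σ·σᵀ·M(t)). (This verifies that the quadratic ansatz solves the Hamilton–Jacobi–Bellman equation 0 = ∂_t V + ⟨Ax+b, ∇V⟩ + (1/2)∇·(σσᵀ∇V) − (1/2)‖∇V‖² with ∇V(t,x) = M(t)x + c(t) and Hessian M(t),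 used in the proof of Theorem 1.) -/
open Matrix

attribute [local instance] Matrix.normedAddCommGroup Matrix.normedSpace

/-- The quadratic ansatz `V(t,x) = ½⟨x, M_t x⟩ + ⟨c_t, x⟩ + δ_t` solves the HJB equation:
its time derivative equals `½‖M_t x + c_t‖² − ⟨Ax + b, M_t x + c_t⟩ − ½ tr(σσᵀ M_t)`. -/
theorem hjb_quadratic_ansatz (d : ℕ) (A σm : Matrix (Fin d) (Fin d) ℝ) (b : Fin d → ℝ)
    (M : ℝ → Matrix (Fin d) (Fin d) ℝ) (c : ℝ → Fin d → ℝ) (δ : ℝ → ℝ)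
    (hMsymm : ∀ t : ℝ, (M t)ᵀ = M t)
    (hM : ∀ t : ℝ, HasDerivAt M (M t * M t - Aᵀ * M t - M t * A) t)
    (hc : ∀ t : ℝ, HasDerivAt c (M t *ᵥ c t - Aᵀ *ᵥ c t - M t *ᵥ b) t)
    (hδ : ∀ t : ℝ, HasDerivAt δ
      ((1/2) * (c t ⬝ᵥ c t) - b ⬝ᵥ c t - (1/2) * (σm * σmᵀ * M t).trace) t) :
    ∀ (x : Fin d → ℝ) (t : ℝ),
      HasDerivAt (fun τ => (1/2) * (x ⬝ᵥ (M τ *ᵥ x)) + c τ ⬝ᵥ x + δ τ)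
        ((1/2) * ((M t *ᵥ x + c t) ⬝ᵥ (M t *ᵥ x + c t))
          - (A *ᵥ x + b) ⬝ᵥ (M t *ᵥ x + c t)
          - (1/2) * (σm * σmᵀ * M t).trace) t := by
  intro x t
  have key : ∀ (N : Matrix (Fin d) (Fin d) ℝ) (u v : Fin d → ℝ),
      u ⬝ᵥ (N *ᵥ v) = (Nᵀ *ᵥ u) ⬝ᵥ v := by
    intro N u v
    rw [Matrix.dotProduct_mulVec, Matrix.mulVec_transpose]
  have h1 : HasDerivAt (fun τ => x ⬝ᵥ (M τ *ᵥ x))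
      (x ⬝ᵥ ((M t * M t - Aᵀ * M t - M t * A) *ᵥ x)) t := by
    let L : Matrix (Fin d) (Fin d) ℝ →ₗ[ℝ] ℝ :=
      { toFun := fun N => x ⬝ᵥ (N *ᵥ x)
        map_add' := fun N P => by rw [Matrix.add_mulVec, dotProduct_add]
        map_smul' := fun r N => by
          rw [Matrix.smul_mulVec, dotProduct_smul, RingHom.id_apply] }
    exact (LinearMap.toContinuousLinearMap L).hasFDerivAt.comp_hasDerivAt t (hM t)
  have h2 : HasDerivAt (fun τ => c τ ⬝ᵥ x)
      ((M t *ᵥ c t - Aᵀ *ᵥ c t - M t *ᵥ b) ⬝ᵥ x) t := by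
    let L : (Fin d → ℝ) →ₗ[ℝ] ℝ :=
      { toFun := fun v => v ⬝ᵥ x
        map_add' := fun N P => by rw [add_dotProduct]
        map_smul' := fun r N => by rw [smul_dotProduct, RingHom.id_apply] }
    exact (LinearMap.toContinuousLinearMap L).hasFDerivAt.comp_hasDerivAt t (hc t)
  have h := ((h1.const_mul (1/2)).add h2).add (hδ t)
  refine h.congr_deriv ?_
  have e1 : x ⬝ᵥ (M t *ᵥ (M t *ᵥ x)) = (M t *ᵥ x) ⬝ᵥ (M t *ᵥ x) := by
    rw [key, hMsymm]
  have e2 : x ⬝ᵥ (Aᵀ *ᵥ (M t *ᵥ x)) = (A *ᵥ x) ⬝ᵥ (M t *ᵥ x) := by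
    rw [key, Matrix.transpose_transpose]
  have e3 : x ⬝ᵥ (M t *ᵥ (A *ᵥ x)) = (A *ᵥ x) ⬝ᵥ (M t *ᵥ x) := by
    rw [key, hMsymm, dotProduct_comm]
  have e4 : (M t *ᵥ c t) ⬝ᵥ x = c t ⬝ᵥ (M t *ᵥ x) := by
    rw [key, hMsymm]
  have e5 : (Aᵀ *ᵥ c t) ⬝ᵥ x = (A *ᵥ x) ⬝ᵥ c t := by
    rw [← key, dotProduct_comm]
  have e6 : (M t *ᵥ b) ⬝ᵥ x = b ⬝ᵥ (M t *ᵥ x) := by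
    rw [key, hMsymm]
  have e7 : (M t *ᵥ x) ⬝ᵥ c t = c t ⬝ᵥ (M t *ᵥ x) := dotProduct_comm _ _
  simp only [Matrix.sub_mulVec, ← Matrix.mulVec_mulVec, dotProduct_sub, sub_dotProduct,
    dotProduct_add, add_dotProduct, e1, e2, e3, e4, e5, e6, e7]
  ring
end

section
/- Let ρ₀ and ρ_T be probability measures on ℝ^d with strictly positive measurable densities f₀ and f_T with respect to Lebesgue measure, let Σ be a symmetric positive-definite d×d real matrix, and let μ : ℝ^d → ℝ^d be measurable. Let Q be the probability measure on ℝ^d × ℝ^d with Lebesgue density q(x₀, x_T) = f₀(x₀) · ((2π)^d det Σ)^{−1/2} · exp(−(1/2)·⟨x_T − μ(x₀), Σ⁻¹(x_T − μ(x₀))⟩). Then for every coupling π of (ρ₀, ρ_T) (a probability measure on ℝ^d × ℝ^d with first marginal ρ₀ and second marginal ρ_T) that is absolutely continuous with respect to ρ₀ ⊗ ρ_T, and under the integrability assumptions that log f_T is ρ_T-integrable, the quadratic form (x₀,x_T) ↦ ⟨x_T − μ(x₀), Σ⁻¹(x_T − μ(x₀))⟩ is π-integrable, and the Kullback–Leibler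 divergences below are finite, one has KL(π ‖ Q) = (1/2)·∫ ⟨x_T − μ(x₀), Σ⁻¹(x_T − μ(x₀))⟩ dπ(x₀, x_T) + KL(π ‖ ρ₀ ⊗ ρ_T) + ∫ log f_T(x_T) dρ_T(x_T) + (1/2)·log((2π)^d · det Σ). In particular, the last two terms do not depend on π, so minimising KL(π ‖ Q) over couplings of (ρ₀, ρ_T) is equivalent to minimising the entropic transport functional π ↦ (1/2)∫⟨x_T − μ(x₀), Σ⁻¹(x_T − μ(x₀))⟩ dπ + KL(π ‖ ρ₀ ⊗ ρ_T). (This is Proposition 1: the static Schrödinger bridge problem with multivariate Ornstein–Uhlenbeck reference shares its minimiser with a generalised entropic optimal transport problem, where μ(x₀) = μ_T^{x₀} is the reference mean map and Σ = Σ_T is the reference transition covariance.) -/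
open Matrix MeasureTheory

/-- Kullback–Leibler divergence `∫ log (dμ/dν) dμ`. -/
noncomputable def klDiv {α : Type*} [MeasurableSpace α] (μ ν : Measure α) : ℝ :=
  ∫ x, Real.log ((μ.rnDeriv ν x).toReal) ∂μ

/-- The static Schrödinger bridge problem with multivariate Ornstein–Uhlenbeck reference is
equivalent to a generalised entropic optimal transport problem: for any coupling `π` of
`(ρ₀, ρ_T)`, `KL(π‖Q)` equals the entropic transport functional plus terms independent of `π`. -/
theorem static_sbp_eot (d : ℕ)
    (ρ₀ ρT : Measure (Fin d → ℝ))
    [IsProbabilityMeasure ρ₀] [IsProbabilityMeasure ρT]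
    (f₀ fT : (Fin d → ℝ) → ℝ)
    (hf₀_meas : Measurable f₀) (hfT_meas : Measurable fT)
    (hf₀_pos : ∀ x, 0 < f₀ x) (hfT_pos : ∀ x, 0 < fT x)
    (hρ₀ : ρ₀ = volume.withDensity fun x => ENNReal.ofReal (f₀ x))
    (hρT : ρT = volume.withDensity fun x => ENNReal.ofReal (fT x))
    (Sg : Matrix (Fin d) (Fin d) ℝ) (hSg : Sg.PosDef)
    (μmap : (Fin d → ℝ) → (Fin d → ℝ)) (hμmap : Measurable μmap)
    (Q : Measure ((Fin d → ℝ) × (Fin d → ℝ)))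
    (hQ : Q = volume.withDensity fun p => ENNReal.ofReal
      (f₀ p.1 * ((2 * Real.pi) ^ d * Sg.det) ^ (-(1/2) : ℝ) *
        Real.exp (-(1/2) * ((p.2 - μmap p.1) ⬝ᵥ (Sg⁻¹ *ᵥ (p.2 - μmap p.1)))))) :
    ∀ π : Measure ((Fin d → ℝ) × (Fin d → ℝ)), IsProbabilityMeasure π →
      π.map Prod.fst = ρ₀ → π.map Prod.snd = ρT →
      π ≪ ρ₀.prod ρT →
      Integrable (fun x => Real.log (fT x)) ρT →
      Integrable (fun p => (p.2 - μmap p.1) ⬝ᵥ (Sg⁻¹ *ᵥ (p.2 - μmap p.1))) π →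
      Integrable (fun p => Real.log ((π.rnDeriv Q p).toReal)) π →
      Integrable (fun p => Real.log ((π.rnDeriv (ρ₀.prod ρT) p).toReal)) π →
      klDiv π Q =
        (1/2) * (∫ p, (p.2 - μmap p.1) ⬝ᵥ (Sg⁻¹ *ᵥ (p.2 - μmap p.1)) ∂π)
          + klDiv π (ρ₀.prod ρT)
          + (∫ x, Real.log (fT x) ∂ρT)
          + (1/2) * Real.log ((2 * Real.pi) ^ d * Sg.det) := by
  intro π hπ hfst hsnd hac hlogT hquad hklQ hklP
  have hdet : 0 < Sg.det := hSg.det_pos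
  set C : ℝ := (2 * Real.pi) ^ d * Sg.det with hC
  have hCpos : 0 < C := by positivity
  set c : (Fin d → ℝ) × (Fin d → ℝ) → ℝ :=
    fun p => (p.2 - μmap p.1) ⬝ᵥ (Sg⁻¹ *ᵥ (p.2 - μmap p.1)) with hc
  have hdiff : Measurable (fun p : (Fin d → ℝ) × (Fin d → ℝ) => p.2 - μmap p.1) :=
    measurable_snd.sub (hμmap.comp measurable_fst)
  have hcm : Measurable c := by
    have hcont : Continuous (fun v : Fin d → ℝ => v ⬝ᵥ (Sg⁻¹ *ᵥ v)) := by fun_prop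
    exact hcont.measurable.comp hdiff
  set q : (Fin d → ℝ) × (Fin d → ℝ) → ℝ :=
    fun p => f₀ p.1 * C ^ (-(1/2) : ℝ) * Real.exp (-(1/2) * c p) with hq
  have hqm : Measurable q :=
    ((hf₀_meas.comp measurable_fst).mul_const _).mul ((hcm.const_mul _).exp)
  have hqpos : ∀ p, 0 < q p := fun p =>
    mul_pos (mul_pos (hf₀_pos _) (Real.rpow_pos_of_pos hCpos _)) (Real.exp_pos _)
  set r : (Fin d → ℝ) × (Fin d → ℝ) → ℝ := fun p => f₀ p.1 * fT p.2 with hr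
  have hrm : Measurable r := (hf₀_meas.comp measurable_fst).mul (hfT_meas.comp measurable_snd)
  have hrpos : ∀ p, 0 < r p := fun p => mul_pos (hf₀_pos _) (hfT_pos _)
  have hQ' : Q = volume.withDensity fun p => ENNReal.ofReal (q p) := hQ
  have hP : ρ₀.prod ρT = volume.withDensity fun p => ENNReal.ofReal (r p) := by
    rw [hρ₀, hρT, prod_withDensity hf₀_meas.ennreal_ofReal hfT_meas.ennreal_ofReal]
    simp only [hr, ENNReal.ofReal_mul (hf₀_pos _).le]
    rfl
  have hacv : π ≪ volume := by
    refine hac.trans ?_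
    rw [hP]
    exact withDensity_absolutelyContinuous _ _
  have key : ∀ g : (Fin d → ℝ) × (Fin d → ℝ) → ℝ, Measurable g → (∀ p, 0 < g p) →
      ∀ᵐ p ∂π, Real.log ((π.rnDeriv (volume.withDensity fun p => ENNReal.ofReal (g p)) p).toReal)
        = Real.log ((π.rnDeriv volume p).toReal) - Real.log (g p) := by
    intro g hg hgpos
    have h1 := Measure.rnDeriv_withDensity_right π
      (volume : Measure ((Fin d → ℝ) × (Fin d → ℝ)))
      hg.ennreal_ofReal.aemeasurable
      (Filter.Eventually.of_forall fun p => by simpa using hgpos p)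
      (Filter.Eventually.of_forall fun p => ENNReal.ofReal_ne_top)
    filter_upwards [hacv.ae_le h1, Measure.rnDeriv_pos hacv,
      hacv.ae_le (Measure.rnDeriv_lt_top π volume)] with p hp hp1 hp2
    have h0 : 0 < (π.rnDeriv volume p).toReal := ENNReal.toReal_pos hp1.ne' hp2.ne
    rw [hp, ENNReal.toReal_mul, ENNReal.toReal_inv, ENNReal.toReal_ofReal (hgpos p).le,
      Real.log_mul (inv_ne_zero (hgpos p).ne') h0.ne', Real.log_inv]
    ring
  have hTint : Integrable (fun p : (Fin d → ℝ) × (Fin d → ℝ) => Real.log (fT p.2)) π := by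
    rw [← hsnd] at hlogT
    exact hlogT.comp_measurable measurable_snd
  have hTeq : ∫ x, Real.log (fT x) ∂ρT = ∫ p, Real.log (fT p.2) ∂π := by
    rw [← hsnd]
    exact integral_map measurable_snd.aemeasurable
      (Real.measurable_log.comp hfT_meas).aestronglyMeasurable
  have hmain : ∀ᵐ p ∂π, Real.log ((π.rnDeriv Q p).toReal) =
      (1/2) * c p + Real.log ((π.rnDeriv (ρ₀.prod ρT) p).toReal) + Real.log (fT p.2)
        + (1/2) * Real.log C := by
    rw [hQ', hP]
    filter_upwards [key q hqm hqpos, key r hrm hrpos] with p h1 h2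
    rw [h1, h2]
    have e1 : Real.log (q p) = Real.log (f₀ p.1) + -(1/2) * Real.log C + -(1/2) * c p := by
      simp only [hq]
      rw [Real.log_mul (mul_pos (hf₀_pos _) (Real.rpow_pos_of_pos hCpos _)).ne'
        (Real.exp_pos _).ne', Real.log_mul (hf₀_pos _).ne' (Real.rpow_pos_of_pos hCpos _).ne',
        Real.log_exp, Real.log_rpow hCpos]
    have e2 : Real.log (r p) = Real.log (f₀ p.1) + Real.log (fT p.2) :=
      Real.log_mul (hf₀_pos _).ne' (hfT_pos _).ne'
    rw [e1, e2]
    ring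
  unfold klDiv
  have i1 : Integrable (fun p => (1/2) * c p) π := hquad.const_mul (1/2)
  have i2 : Integrable (fun p => (1/2) * c p
      + Real.log ((π.rnDeriv (ρ₀.prod ρT) p).toReal)) π := i1.add hklP
  have i3 : Integrable (fun p => (1/2) * c p
      + Real.log ((π.rnDeriv (ρ₀.prod ρT) p).toReal) + Real.log (fT p.2)) π := i2.add hTint
  rw [integral_congr_ae hmain, hTeq, integral_add i3 (integrable_const _),
    integral_add i2 hTint, integral_add i1 hklP, integral_const_mul]
  simp
end
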